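/- arXiv:2111.15586 — 2 statements merged into one kernel-verified Lean document; each statement's English description precedes it below -/
import Mathlib

section
/- Let p be a prime and H a finite abelian group of exponent p (i.e., pH = 0). Let G be a weakly controllable group shift over H which is of finite type. Then there exists a noncatastrophic isomorphic encoder for G: there exist m ∈ ℕ and a topological group isomorphism Φ : ((ℤ/pℤ)^m)^ℤ → G such that σ ∘ Φ = Φ ∘ σ and Φ maps the subgroup of finitely supported sequences onto G_f. In particular, G is algebraically and topologically conjugate to the full group shift ((ℤ/pℤ)^m)^ℤ. -/
open Function Topology

/-- The backward shift by `n`: `(shiftPow n x) i = x (i + n)`. -/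
def shiftPow {H : Type*} (n : ℤ) (x : ℤ → H) : ℤ → H := fun i => x (i + n)

/-- The backward shift operator `σ`: `(shift x) i = x (i + 1)`. -/
abbrev shift {H : Type*} (x : ℤ → H) : ℤ → H := shiftPow 1 x

/-- A group shift over `H`: a closed, shift-invariant subgroup of the full shift `H^ℤ`. -/
def IsGroupShift {H : Type*} [AddCommGroup H] [TopologicalSpace H]
    (G : AddSubgroup (ℤ → H)) : Prop :=
  IsClosed (G : Set (ℤ → H)) ∧ shift '' (G : Set (ℤ → H)) = (G : Set (ℤ → H))

/-- `G_f`: the set of finitely supported elements of `G`. -/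
def finSupp {H : Type*} [AddCommGroup H] (G : AddSubgroup (ℤ → H)) : Set (ℤ → H) :=
  {x | x ∈ G ∧ (Function.support x).Finite}

/-- `G` is weakly controllable: `G_f` is dense in `G`. -/
def IsWeaklyControllable {H : Type*} [AddCommGroup H] [TopologicalSpace H]
    (G : AddSubgroup (ℤ → H)) : Prop :=
  (G : Set (ℤ → H)) ⊆ closure (finSupp G)

/-- `G` is a shift of finite type: there is `N` such that whenever two elements of `G`
agree on a block `[k, k+N]`, they can be glued along this block inside `G`. -/
def IsFiniteType {H : Type*} [AddCommGroup H] (G : AddSubgroup (ℤ → H)) : Prop :=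
  ∃ N : ℕ, ∀ x₁ ∈ G, ∀ x₂ ∈ G, ∀ k : ℤ,
    (∀ i : ℤ, k ≤ i → i ≤ k + N → x₁ i = x₂ i) →
    ∃ x ∈ G, (∀ i : ℤ, i ≤ k + N → x i = x₁ i) ∧ (∀ i : ℤ, k ≤ i → x i = x₂ i)

/-- A noncatastrophic isomorphic encoder for `G` with symbol group `K`:
a topological group isomorphism `Φ : K^ℤ → G` commuting with the shift and
mapping the finitely supported sequences onto `G_f`. -/
def IsNoncatEncoder {H : Type*} [AddCommGroup H] [TopologicalSpace H]
    (G : AddSubgroup (ℤ → H)) (K : Type*) [AddCommGroup K] [TopologicalSpace K] : Prop :=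
  ∃ Φ : (ℤ → K) ≃+ G,
    Continuous Φ ∧ Continuous Φ.symm ∧
    (∀ u : ℤ → K, ((Φ (shift u) : ℤ → H)) = shift ((Φ u : ℤ → H))) ∧
    ((fun u : ℤ → K => ((Φ u : ℤ → H))) '' {u | (Function.support u).Finite} = finSupp G)

open Module Polynomial

section Shift

variable {H : Type*}

theorem shiftPow_shiftPow (m n : ℤ) (x : ℤ → H) :
    shiftPow m (shiftPow n x) = shiftPow (m + n) x := by
  ext i
  simp only [shiftPow, add_assoc]

theorem shiftPow_zero (x : ℤ → H) : shiftPow 0 x = x := by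
  ext i
  simp only [shiftPow, add_zero]

theorem shiftPow_mem [AddCommGroup H] {G : AddSubgroup (ℤ → H)}
    (hσ : shift '' (G : Set (ℤ → H)) = G) (n : ℤ) {x : ℤ → H} (hx : x ∈ G) :
    shiftPow n x ∈ G := by
  induction n with
  | zero => rwa [shiftPow_zero]
  | succ n ih =>
    have h : shift (shiftPow (n : ℤ) x) ∈ (G : Set (ℤ → H)) := hσ ▸ Set.mem_image_of_mem _ ih
    rwa [shift, shiftPow_shiftPow, add_comm] at h
  | pred n ih =>
    have h : shiftPow (-(n : ℤ)) x ∈ shift '' (G : Set (ℤ → H)) := by rwa [hσ]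
    obtain ⟨y, hy, hyx⟩ := h
    have : shiftPow (-(n : ℤ) - 1) x = y := by
      rw [sub_eq_neg_add, ← shiftPow_shiftPow, ← hyx, shift, shiftPow_shiftPow, neg_add_cancel,
        shiftPow_zero]
    rwa [this]

/-- The action of `σ ^ n` on a shift-invariant subgroup. -/
def shiftHom [AddCommGroup H] {G : AddSubgroup (ℤ → H)}
    (hσ : shift '' (G : Set (ℤ → H)) = G) (n : ℤ) : G →+ G where
  toFun x := ⟨shiftPow n x, shiftPow_mem hσ n x.2⟩
  map_zero' := rfl
  map_add' _ _ := rfl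

end Shift

section Dual

variable {p : ℕ} [Fact p.Prime] {H : Type*} [AddCommGroup H] {G : AddSubgroup (ℤ → H)}
  (hσ : shift '' (G : Set (ℤ → H)) = G)

theorem coe_shiftHom (n : ℤ) (x : G) : (shiftHom hσ n x : ℤ → H) = shiftPow n x := rfl

theorem shiftHom_shiftHom (m n : ℤ) (x : G) :
    shiftHom hσ m (shiftHom hσ n x) = shiftHom hσ (m + n) x :=
  Subtype.ext (shiftPow_shiftPow m n (x : ℤ → H))

theorem shiftHom_zero (x : G) : shiftHom hσ 0 x = x :=
  Subtype.ext (shiftPow_zero (x : ℤ → H))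

variable [Module (ZMod p) G]

variable (p) in
/-- The algebraic dual of `G`, viewed as a module over the polynomial ring
with `X` acting by precomposition with the shift. -/
@[nolint unusedArguments]
def ShiftDual (_ : shift '' (G : Set (ℤ → H)) = G) : Type _ := Dual (ZMod p) G

noncomputable instance : AddCommGroup (ShiftDual p hσ) :=
  inferInstanceAs (AddCommGroup (Dual (ZMod p) G))

noncomputable instance : Module (ZMod p) (ShiftDual p hσ) :=
  inferInstanceAs (Module (ZMod p) (Dual (ZMod p) G))

noncomputable instance : Module (ZMod p)[X] (ShiftDual p hσ) :=
  Module.compHom (Dual (ZMod p) G)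
    (aeval ((shiftHom hσ 1).toZModLinearMap p).dualMap :
      (ZMod p)[X] →ₐ[ZMod p] Module.End (ZMod p) (Dual (ZMod p) G)).toRingHom

/-- The linear functional on `G` underlying an element of `ShiftDual`. -/
noncomputable def ShiftDual.eval : ShiftDual p hσ ≃ₗ[ZMod p] Dual (ZMod p) G :=
  LinearEquiv.refl _ _

theorem ShiftDual.eval_smul (a : (ZMod p)[X]) (h : ShiftDual p hσ) :
    eval hσ (a • h) =
      (aeval ((shiftHom hσ 1).toZModLinearMap p).dualMap a : Module.End (ZMod p) _)
        (eval hσ h) := rfl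

instance : IsScalarTower (ZMod p) (ZMod p)[X] (ShiftDual p hσ) where
  smul_assoc r a h := (ShiftDual.eval hσ).injective <| by
    rw [ShiftDual.eval_smul, map_smul, map_smul, LinearMap.smul_apply, ShiftDual.eval_smul]

theorem ShiftDual.eval_smul_apply (a : (ZMod p)[X]) (h : ShiftDual p hσ) (x : G) :
    eval hσ (a • h) x =
      ∑ n ∈ Finset.range (a.natDegree + 1), a.coeff n * eval hσ h (shiftHom hσ n x) := by
  have hpow : ∀ (n : ℕ) (f : Dual (ZMod p) G),
      ((((shiftHom hσ 1).toZModLinearMap p).dualMap ^ n : Module.End (ZMod p) _) f) x =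
        f (shiftHom hσ n x) := by
    intro n
    induction n with
    | zero => intro f; simp [shiftHom_zero]
    | succ n ih =>
      intro f
      rw [pow_succ, Module.End.mul_apply, ih, LinearMap.dualMap_apply,
        AddMonoidHom.coe_toZModLinearMap, shiftHom_shiftHom]
      simp [add_comm]
  rw [eval_smul, aeval_eq_sum_range]
  simp only [LinearMap.sum_apply, LinearMap.smul_apply, hpow, smul_eq_mul]

theorem ShiftDual.eval_X_pow_smul_apply (n : ℕ) (h : ShiftDual p hσ) (x : G) :
    eval hσ ((X ^ n : (ZMod p)[X]) • h) x = eval hσ h (shiftHom hσ n x) := by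
  rw [eval_smul_apply, Finset.sum_eq_single n] <;> simp +contextual [coeff_X_pow]

variable [Module (ZMod p) H]

variable (p G) in
/-- The coordinate at `0`, as a linear map on `G`. -/
def coordZero : G →ₗ[ZMod p] H :=
  ((Pi.evalAddMonoidHom (fun _ : ℤ => H) 0).comp G.subtype).toZModLinearMap p

theorem coordZero_apply (x : G) : coordZero p G x = (x : ℤ → H) 0 := rfl

variable (p) in
/-- The polynomial submodule of the dual generated by functionals of the coordinate at `0`. -/
noncomputable def coordDual : Submodule (ZMod p)[X] (ShiftDual p hσ) :=
  Submodule.span _ (Set.range fun φ : Dual (ZMod p) H =>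
    (ShiftDual.eval hσ).symm (φ ∘ₗ coordZero p G))

theorem exists_window {h : ShiftDual p hσ} (hh : h ∈ coordDual p hσ) :
    ∃ N : ℕ, ∀ x : G, (∀ i : ℤ, 0 ≤ i → i ≤ N → (x : ℤ → H) i = 0) →
      ShiftDual.eval hσ h x = 0 := by
  induction hh using Submodule.span_induction with
  | mem h hh =>
    obtain ⟨φ, rfl⟩ := hh
    refine ⟨0, fun x hx => ?_⟩
    simp [coordZero_apply, hx 0 le_rfl le_rfl]
  | zero => exact ⟨0, fun x _ => by simp⟩
  | add h₁ h₂ _ _ ih₁ ih₂ =>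
    obtain ⟨N₁, hN₁⟩ := ih₁
    obtain ⟨N₂, hN₂⟩ := ih₂
    refine ⟨N₁ + N₂, fun x hx => ?_⟩
    rw [map_add, LinearMap.add_apply, hN₁ x fun i h0 hi => hx i h0 (by push_cast; lia),
      hN₂ x fun i h0 hi => hx i h0 (by push_cast; lia), add_zero]
  | smul a h _ ih =>
    obtain ⟨N, hN⟩ := ih
    refine ⟨N + a.natDegree, fun x hx => ?_⟩
    rw [ShiftDual.eval_smul_apply]
    refine Finset.sum_eq_zero fun n hn => ?_
    rw [Finset.mem_range] at hn
    rw [hN _ fun i h0 hi => hx (i + n) (by lia) (by push_cast; lia), mul_zero]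

theorem finite_support_eval {h : ShiftDual p hσ} (hh : h ∈ coordDual p hσ) {x : G}
    (hx : (support (x : ℤ → H)).Finite) :
    (support fun i : ℤ => ShiftDual.eval hσ h (shiftHom hσ i x)).Finite := by
  obtain ⟨N, hN⟩ := exists_window hσ hh
  refine ((hx.prod (Set.finite_Icc (0 : ℤ) N)).image fun q => q.1 - q.2).subset fun i hi => ?_
  by_contra hcon
  refine hi (hN _ fun j h0 hj => ?_)
  by_contra hne
  exact hcon ⟨(j + i, j), ⟨hne, h0, hj⟩, by simp⟩

theorem continuous_eval [TopologicalSpace H] [DiscreteTopology H] {h : ShiftDual p hσ}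
    (hh : h ∈ coordDual p hσ) : Continuous (ShiftDual.eval hσ h) := by
  obtain ⟨N, hN⟩ := exists_window hσ hh
  refine IsLocallyConstant.continuous ((IsLocallyConstant.iff_exists_open _).2 fun x => ?_)
  refine ⟨Subtype.val ⁻¹' (Set.Icc (0 : ℤ) N).pi fun i => {(x : ℤ → H) i},
    (isOpen_set_pi (Set.finite_Icc _ _) fun i _ => isOpen_discrete _).preimage
      continuous_subtype_val, fun i _ => rfl, fun y hy => ?_⟩
  rw [← sub_eq_zero, ← map_sub]
  refine hN _ fun i h0 hi => ?_
  have := hy i ⟨h0, hi⟩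
  simpa [sub_eq_zero] using this

theorem eq_zero_of_sum_eq_zero {a : (ZMod p)[X]} (ha : a ≠ 0) {g : ℤ → ZMod p}
    (hg : (support g).Finite)
    (hag : ∀ i : ℤ, ∑ n ∈ Finset.range (a.natDegree + 1), a.coeff n * g (n + i) = 0) :
    g = 0 := by
  by_contra hne
  obtain ⟨M, hM, hmax⟩ := hg.exists_maximal (support_nonempty_iff.2 hne)
  have h := hag (M - a.natTrailingDegree)
  rw [Finset.sum_eq_single a.natTrailingDegree] at h
  · rw [add_sub_cancel] at h
    exact mul_ne_zero (by rwa [← trailingCoeff, trailingCoeff_nonzero_iff_nonzero]) hM h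
  · intro n _ hn
    rcases lt_or_gt_of_ne hn with hlt | hgt
    · rw [coeff_eq_zero_of_lt_natTrailingDegree hlt, zero_mul]
    · by_cases hz : g (n + (M - a.natTrailingDegree)) = 0
      · rw [hz, mul_zero]
      · have := hmax hz (by lia)
        lia
  · intro hn
    exact absurd (Finset.mem_range.2 (Nat.lt_succ_of_le (natTrailingDegree_le_natDegree a))) hn

theorem isTorsionFree_coordDual [TopologicalSpace H] [DiscreteTopology H]
    (hwc : IsWeaklyControllable G) : Module.IsTorsionFree (ZMod p)[X] (coordDual p hσ) := by
  refine Module.isTorsionFree_iff_smul_eq_zero.2 fun a h hah => or_iff_not_imp_left.2 fun ha => ?_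
  have hfin : ∀ x : G, (support (x : ℤ → H)).Finite →
      ShiftDual.eval hσ (h : ShiftDual p hσ) x = 0 := by
    intro x hx
    have hg := eq_zero_of_sum_eq_zero ha (finite_support_eval hσ h.2 hx) fun i => by
      have := ShiftDual.eval_smul_apply hσ a h (shiftHom hσ i x)
      simp only [shiftHom_shiftHom] at this
      rw [← this, ← Submodule.coe_smul, hah]
      simp
    simpa [shiftHom_zero] using congrFun hg 0
  refine Subtype.ext ((ShiftDual.eval hσ).injective ?_)
  rw [Submodule.coe_zero, map_zero]
  ext x
  have hclosed : IsClosed {y : G | ShiftDual.eval hσ (h : ShiftDual p hσ) y = 0} :=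
    isClosed_eq (continuous_eval hσ h.2) continuous_const
  refine closure_minimal (s := {y : G | (support (y : ℤ → H)).Finite}) hfin hclosed ?_
  rw [closure_subtype]
  convert hwc x.2 using 2
  ext y
  simp [finSupp, and_comm]

theorem exists_basis_coordDual [Finite H] [TopologicalSpace H] [DiscreteTopology H]
    (hwc : IsWeaklyControllable G) :
    ∃ m : ℕ, Nonempty (Basis (Fin m) (ZMod p)[X] (coordDual p hσ)) := by
  have : Finite (Dual (ZMod p) H) := DFunLike.finite _
  have : Module.Finite (ZMod p)[X] (coordDual p hσ) :=
    Module.Finite.of_fg (Submodule.fg_span (Set.finite_range _))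
  have := isTorsionFree_coordDual (p := p) hσ hwc
  have : Module.Free (ZMod p)[X] (coordDual p hσ) := Module.free_of_finite_type_torsion_free'
  exact ⟨_, ⟨Module.finBasis (ZMod p)[X] (coordDual p hσ)⟩⟩

theorem exists_eval_eq_of_linearIndependent {K V ι : Type*} [Field K] [AddCommGroup V] [Module K V]
    [Fintype ι] {f : ι → Dual K V} (hf : LinearIndependent K f) (c : ι → K) :
    ∃ x : V, ∀ i, f i x = c i := by
  classical
  have hs : Surjective (LinearMap.pi f) := by
    rw [← LinearMap.dualMap_injective_iff, injective_iff_map_eq_zero]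
    intro φ hφ
    have hz := Fintype.linearIndependent_iff.1 hf (fun i => φ (Pi.single i 1)) (by
      rw [← hφ]
      ext x
      rw [LinearMap.dualMap_apply, LinearMap.pi_apply_eq_sum_univ φ, LinearMap.sum_apply]
      refine Finset.sum_congr rfl fun i _ => ?_
      rw [LinearMap.smul_apply, smul_eq_mul, smul_eq_mul, mul_comm, LinearMap.pi_apply]
      congr 3
      ext k
      simp [Pi.single_apply, eq_comm])
    exact LinearMap.pi_ext' fun i => LinearMap.ext_ring (by simpa using hz i)
  obtain ⟨x, hx⟩ := hs c
  exact ⟨x, congrFun hx⟩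

variable {m : ℕ} (b : Basis (Fin m) (ZMod p)[X] (coordDual p hσ))

/-- The sliding block map reading off the functionals in a family `b`. -/
noncomputable def readout : G →+ (ℤ → Fin m → ZMod p) where
  toFun x i j := ShiftDual.eval hσ (b j) (shiftHom hσ i x)
  map_zero' := by ext; simp
  map_add' _ _ := by ext; simp

theorem readout_apply (x : G) (i : ℤ) (j : Fin m) :
    readout hσ b x i j = ShiftDual.eval hσ (b j) (shiftHom hσ i x) := rfl

theorem readout_shiftHom (n : ℤ) (x : G) :
    readout hσ b (shiftHom hσ n x) = shiftPow n (readout hσ b x) := by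
  ext i j
  simp only [readout_apply, shiftHom_shiftHom, shiftPow]

theorem continuous_readout [TopologicalSpace H] [DiscreteTopology H] :
    Continuous (readout hσ b) := by
  refine continuous_pi fun i => continuous_pi fun j => (continuous_eval hσ (b j).2).comp ?_
  exact Continuous.subtype_mk (continuous_pi fun k =>
    (continuous_apply (A := fun _ : ℤ => H) (k + i)).comp continuous_subtype_val) _

theorem readout_injective : Injective (readout hσ b) := by
  rw [injective_iff_map_eq_zero]
  intro x hx
  have key : ∀ h : coordDual p hσ, ∀ i : ℤ,
      ShiftDual.eval hσ (h : ShiftDual p hσ) (shiftHom hσ i x) = 0 := by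
    intro h i
    rw [← b.sum_repr h, Submodule.coe_sum, map_sum, LinearMap.sum_apply]
    refine Finset.sum_eq_zero fun j _ => ?_
    rw [Submodule.coe_smul, ShiftDual.eval_smul_apply]
    refine Finset.sum_eq_zero fun n _ => ?_
    rw [shiftHom_shiftHom, ← readout_apply, hx, Pi.zero_apply, Pi.zero_apply, mul_zero]
  ext i
  refine (forall_dual_apply_eq_zero_iff (ZMod p) _).1 fun φ => ?_
  have := key ⟨_, Submodule.subset_span ⟨φ, rfl⟩⟩ i
  simpa [coordZero_apply, coe_shiftHom, shiftPow] using this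

theorem linearIndependent_eval_basis :
    LinearIndependent (ZMod p) fun q : ℕ × Fin m =>
      ShiftDual.eval hσ ((X ^ q.1 : (ZMod p)[X]) • (b q.2 : ShiftDual p hσ)) := by
  let L : coordDual p hσ →ₗ[ZMod p] Dual (ZMod p) G :=
    (ShiftDual.eval hσ).toLinearMap ∘ₗ (coordDual p hσ).subtype.restrictScalars (ZMod p)
  have hL : LinearMap.ker L = ⊥ :=
    LinearMap.ker_eq_bot.2 ((ShiftDual.eval hσ).injective.comp Subtype.val_injective)
  have hb : (fun q : ℕ × Fin m =>
      ShiftDual.eval hσ ((X ^ q.1 : (ZMod p)[X]) • (b q.2 : ShiftDual p hσ))) =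
      L ∘ (basisMonomials (ZMod p)).smulTower b := by
    ext1 q
    simp [L, monomial_one_right_eq_X_pow]
  rw [hb]
  exact ((basisMonomials (ZMod p)).smulTower b).linearIndependent.map' L hL

theorem denseRange_readout : DenseRange (readout hσ b) := by
  intro u
  rw [mem_closure_iff]
  intro o ho hu
  obtain ⟨I, U, hU, hsub⟩ := isOpen_pi_iff.1 ho u hu
  obtain ⟨N, hN⟩ : ∃ N : ℕ, ∀ i ∈ I, |i| ≤ N :=
    ⟨∑ i ∈ I, i.natAbs, fun i hi => by
      rw [Int.abs_eq_natAbs]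
      exact_mod_cast Finset.single_le_sum (f := Int.natAbs) (fun _ _ => Nat.zero_le _) hi⟩
  obtain ⟨y, hy⟩ := exists_eval_eq_of_linearIndependent
    ((linearIndependent_eval_basis hσ b).comp
      (Prod.map (fun n : Fin (2 * N + 1) => (n : ℕ)) id) (Fin.val_injective.prodMap injective_id))
    fun q => u ((q.1 : ℕ) - N : ℤ) q.2
  refine ⟨_, hsub fun i hi => ?_, shiftHom hσ N y, rfl⟩
  have hiN := abs_le.1 (hN i hi)
  convert (hU i hi).2
  ext j
  obtain ⟨n, hn⟩ := Int.eq_ofNat_of_zero_le (show 0 ≤ i + N by lia)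
  have := hy (⟨n, by lia⟩, j)
  simp only [comp_apply, Prod.map_apply, id_eq, ShiftDual.eval_X_pow_smul_apply] at this
  rw [readout_apply, shiftHom_shiftHom, hn, this, ← hn, add_sub_cancel_right]

theorem readout_bijective [Finite H] [TopologicalSpace H] [DiscreteTopology H]
    (hG : IsClosed (G : Set (ℤ → H))) : Bijective (readout hσ b) := by
  have : CompactSpace G := isCompact_iff_compactSpace.1 hG.isCompact
  refine ⟨readout_injective hσ b, Set.range_eq_univ.1 ?_⟩
  rw [← (isCompact_range (continuous_readout hσ b)).isClosed.closure_eq]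
  exact (denseRange_readout hσ b).closure_range

end Dual

theorem exists_finset_forall_eq_zero {ι A B F : Type*} [Zero A] [Zero B] [TopologicalSpace A]
    [DiscreteTopology A] [TopologicalSpace B] [DiscreteTopology B]
    [FunLike F (ι → A) B] [ZeroHomClass F (ι → A) B] (f : F) (hf : Continuous f) :
    ∃ I : Finset ι, ∀ u : ι → A, (∀ i ∈ I, u i = 0) → f u = 0 := by
  obtain ⟨I, U, hU, hsub⟩ := isOpen_pi_iff.1 ((isOpen_discrete ({0} : Set B)).preimage hf) 0
    (map_zero f)
  exact ⟨I, fun u hu => hsub fun i hi => by rw [hu i hi]; exact (hU i hi).2⟩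

/-- Let `p` be a prime and `H` a finite abelian group of exponent `p`.
If `G` is a weakly controllable group shift over `H` of finite type, then for some `m`
there is a noncatastrophic isomorphic encoder `Φ : ((ℤ/pℤ)^m)^ℤ → G`; in particular `G` is
algebraically and topologically conjugate to the full group shift `((ℤ/pℤ)^m)^ℤ`. -/
theorem exponent_p_noncatastrophic_encoder
    (p : ℕ) (hp : p.Prime)
    {H : Type} [AddCommGroup H] [Fintype H] [TopologicalSpace H] [DiscreteTopology H]
    (hexp : ∀ a : H, p • a = 0)
    (G : AddSubgroup (ℤ → H)) (hG : IsGroupShift G)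
    (hwc : IsWeaklyControllable G) (hft : IsFiniteType G) :
    ∃ m : ℕ, IsNoncatEncoder G (Fin m → ZMod p) := by
  have : Fact p.Prime := ⟨hp⟩
  let _ : Module (ZMod p) H := AddCommGroup.zmodModule hexp
  let _ : Module (ZMod p) G :=
    AddCommGroup.zmodModule fun x => Subtype.ext (funext fun i => hexp ((x : ℤ → H) i))
  obtain ⟨hclosed, hσ⟩ := hG
  obtain ⟨m, ⟨b⟩⟩ := exists_basis_coordDual (p := p) hσ hwc
  have : CompactSpace G := isCompact_iff_compactSpace.1 hclosed.isCompact
  let Ψ : G ≃+ (ℤ → Fin m → ZMod p) :=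
    AddEquiv.ofBijective (readout hσ b) (readout_bijective hσ b hclosed)
  have hΨ : Continuous Ψ := continuous_readout hσ b
  have hΨsymm : Continuous Ψ.symm := (hΨ.homeoOfEquivCompactToT2 (f := Ψ.toEquiv)).symm.continuous
  have hcomm (n : ℤ) (u : ℤ → Fin m → ZMod p) :
      Ψ.symm (shiftPow n u) = shiftHom hσ n (Ψ.symm u) := by
    rw [AddEquiv.symm_apply_eq]
    refine Eq.trans ?_ (readout_shiftHom hσ b n (Ψ.symm u)).symm
    exact congrArg _ (Ψ.apply_symm_apply u).symm
  refine ⟨m, Ψ.symm, hΨsymm, hΨ, fun u => congrArg Subtype.val (hcomm 1 u), ?_⟩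
  ext x
  constructor
  · rintro ⟨u, hu, rfl⟩
    refine ⟨(Ψ.symm u).2, ?_⟩
    obtain ⟨I, hI⟩ := exists_finset_forall_eq_zero ((coordZero p G).toAddMonoidHom.comp
      Ψ.symm.toAddMonoidHom) ((continuous_apply (A := fun _ : ℤ => H) 0).comp
        (continuous_subtype_val.comp hΨsymm))
    refine ((Set.Finite.prod hu I.finite_toSet).image fun q => q.1 - q.2).subset fun i hi => ?_
    by_contra hcon
    refine hi ?_
    have h := hI (shiftPow i u) fun k hk => by
      by_contra hne
      exact hcon ⟨(k + i, k), ⟨hne, hk⟩, by simp⟩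
    simpa [hcomm, coordZero_apply, coe_shiftHom, shiftPow] using h
  · rintro ⟨hx, hfin⟩
    refine ⟨Ψ ⟨x, hx⟩, ?_, by simp⟩
    refine (Set.finite_iUnion fun j : Fin m =>
      finite_support_eval hσ (b j).2 (x := ⟨x, hx⟩) hfin).subset fun i hi => ?_
    obtain ⟨j, hj⟩ := Function.ne_iff.1 hi
    exact Set.mem_iUnion.2 ⟨j, hj⟩
end

section
/- Let H be a finite abelian group and let G be an order controllable group shift over H. Then G is of finite type: there exists N ∈ ℕ such that whenever x₁, x₂ ∈ G agree on a block [k, k+N] (k ∈ ℤ), there exists x ∈ G with x(i) = x₁(i) for all i ≤ k+N and x(i) = x₂(i) for all i ≥ k. -/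
open Function Topology

/-- `G` is order controllable. -/
def IsOrderControllable {H : Type*} [AddCommGroup H] (G : AddSubgroup (ℤ → H)) : Prop :=
  ∃ n₀ : ℕ, 0 < n₀ ∧ ∀ g ∈ G, ∃ g₁ ∈ G,
    (∀ i : ℤ, i ≤ 0 → g₁ i = g i) ∧ (∀ i : ℤ, (n₀ : ℤ) < i → g₁ i = 0) ∧
    addOrderOf (fun j : Fin n₀ => g₁ ((j : ℤ) + 1)) ∣
      addOrderOf (fun j : Fin n₀ => g ((j : ℤ) + 1))

section GroupShift

variable {H : Type*} [AddCommGroup H] {G : AddSubgroup (ℤ → H)}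

theorem IsGroupShift.shift_mem_iff [TopologicalSpace H] (hG : IsGroupShift G) (x : ℤ → H) :
    shift x ∈ G ↔ x ∈ G := by
  have hinj : Injective (shift : (ℤ → H) → ℤ → H) := fun x y h => by
    funext i
    simpa [shiftPow] using congrFun h (i - 1)
  rw [← SetLike.mem_coe, ← hG.2, hinj.mem_set_image, SetLike.mem_coe]

theorem IsGroupShift.shiftPow_mem [TopologicalSpace H] (hG : IsGroupShift G) (n : ℤ)
    {x : ℤ → H} (hx : x ∈ G) : shiftPow n x ∈ G := by
  have hstep : ∀ m : ℤ, shiftPow (m + 1) x ∈ G ↔ shiftPow m x ∈ G := fun m => by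
    rw [← hG.shift_mem_iff (shiftPow m x)]
    suffices h : shiftPow (m + 1) x = shift (shiftPow m x) by rw [h]
    funext i
    simp only [shiftPow]
    congr 1
    ring
  induction n using Int.induction_on with
  | zero =>
    suffices h : shiftPow 0 x = x by rwa [h]
    funext i
    simp [shiftPow]
  | succ m ih => exact (hstep _).2 ih
  | pred m ih => exact (hstep _).1 (by simpa using ih)

/-- The values at `0` of the elements of `G` that vanish on `[-n, -1]`. -/
def followerSubgroup (G : AddSubgroup (ℤ → H)) (n : ℕ) : AddSubgroup H where
  carrier := {h | ∃ x ∈ G, (∀ i : ℤ, -n ≤ i → i < 0 → x i = 0) ∧ x 0 = h}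
  zero_mem' := ⟨0, G.zero_mem, by simp, rfl⟩
  add_mem' := by
    rintro _ _ ⟨x, hx, hx0, rfl⟩ ⟨y, hy, hy0, rfl⟩
    exact ⟨x + y, G.add_mem hx hy, fun i h h' => by simp [hx0 i h h', hy0 i h h'], rfl⟩
  neg_mem' := by
    rintro _ ⟨x, hx, hx0, rfl⟩
    exact ⟨-x, G.neg_mem hx, fun i h h' => by simp [hx0 i h h'], rfl⟩

theorem followerSubgroup_antitone (G : AddSubgroup (ℤ → H)) : Antitone (followerSubgroup G) := by
  rintro m n hmn _ ⟨x, hx, hx0, rfl⟩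
  exact ⟨x, hx, fun i h h' => hx0 i (by omega) h', rfl⟩

theorem exists_followerSubgroup_stable [Finite H] (G : AddSubgroup (ℤ → H)) :
    ∃ N, ∀ n, N ≤ n → followerSubgroup G N = followerSubgroup G n :=
  WellFoundedGT.monotone_chain_condition
    (⟨fun n => OrderDual.toDual (followerSubgroup G n), followerSubgroup_antitone G⟩ :
      ℕ →o (AddSubgroup H)ᵒᵈ)

/-- If the follower subgroups are constant from `N` on, then an element of `G` vanishing on
`[-N, -1]` may be replaced by one vanishing on `[-M, -1]` without changing it on `[0, L)`. -/
theorem exists_mem_extend_zeros [TopologicalSpace H] (hG : IsGroupShift G) {N : ℕ}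
    (hN : ∀ n, N ≤ n → followerSubgroup G N = followerSubgroup G n)
    {x : ℤ → H} (hx : x ∈ G) (hx0 : ∀ i : ℤ, -N ≤ i → i < 0 → x i = 0) {M : ℕ} (hM : N ≤ M)
    (L : ℕ) :
    ∃ y ∈ G, (∀ i : ℤ, -M ≤ i → i < 0 → y i = 0) ∧ ∀ i : ℤ, 0 ≤ i → i < L → y i = x i := by
  induction L with
  | zero => exact ⟨0, G.zero_mem, fun _ _ _ => rfl, fun i h h' => by omega⟩
  | succ L ih =>
    obtain ⟨y, hy, hy0, hyx⟩ := ih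
    have hmem : x L - y L ∈ followerSubgroup G (M + L) := by
      rw [← hN _ (by omega)]
      refine ⟨shiftPow L (x - y), hG.shiftPow_mem _ (G.sub_mem hx hy), fun i h h' => ?_, ?_⟩
      · rcases lt_or_ge (i + L) 0 with hneg | hpos
        · simp [shiftPow, hx0 _ (by omega) hneg, hy0 _ (by omega) hneg]
        · simp [shiftPow, hyx _ hpos (by omega)]
      · simp [shiftPow]
    obtain ⟨z, hz, hz0, hzL⟩ := hmem
    refine ⟨y + shiftPow (-L) z, G.add_mem hy (hG.shiftPow_mem _ hz), fun i h h' => ?_,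
      fun i h h' => ?_⟩
    · simp [shiftPow, hy0 i h h', hz0 (i + -L) (by omega) (by omega)]
    · rcases eq_or_ne i L with rfl | hne
      · simp [shiftPow, hzL]
      · simp [shiftPow, hyx i h (by omega), hz0 (i + -L) (by omega) (by omega)]

theorem exists_mem_truncate [Finite H] [TopologicalSpace H] [DiscreteTopology H]
    (hG : IsGroupShift G) {N : ℕ}
    (hN : ∀ n, N ≤ n → followerSubgroup G N = followerSubgroup G n)
    {x : ℤ → H} (hx : x ∈ G) (hx0 : ∀ i : ℤ, -N ≤ i → i < 0 → x i = 0) :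
    ∃ y ∈ G, (∀ i : ℤ, i < 0 → y i = 0) ∧ ∀ i : ℤ, 0 ≤ i → y i = x i := by
  let C : ℕ → Set (ℤ → H) := fun M =>
    (G : Set (ℤ → H)) ∩ ⋂ i ∈ Set.Ico (-M : ℤ) M, {y | y i = if i < 0 then 0 else x i}
  have hclosed : ∀ M, IsClosed (C M) := fun M =>
    hG.1.inter <| isClosed_biInter fun i _ => isClosed_eq (continuous_apply i) continuous_const
  have hanti : ∀ M, C (M + 1) ⊆ C M := fun M =>
    Set.inter_subset_inter_right _ <| Set.biInter_subset_biInter_left <|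
      Set.Ico_subset_Ico (by push_cast; omega) (by push_cast; omega)
  have hne : ∀ M, (C M).Nonempty := fun M => by
    obtain ⟨y, hy, hy0, hyx⟩ :=
      exists_mem_extend_zeros hG hN hx hx0 (Nat.le_max_left N M) M
    refine ⟨y, hy, Set.mem_iInter₂.2 fun i hi => ?_⟩
    obtain ⟨h, h'⟩ := hi
    rcases lt_or_ge i 0 with hneg | hpos
    · simpa [hneg] using hy0 i (by omega) hneg
    · simpa [hpos.not_gt] using hyx i hpos h'
  obtain ⟨y, hy⟩ := IsCompact.nonempty_iInter_of_sequence_nonempty_isCompact_isClosed C hanti hne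
    (hclosed 0).isCompact hclosed
  have hy' : ∀ i : ℤ, y i = if i < 0 then 0 else x i := fun i =>
    Set.mem_iInter₂.1 (Set.mem_iInter.1 hy (i.natAbs + 1)).2 i
      ⟨by omega, by omega⟩
  exact ⟨y, (Set.mem_iInter.1 hy 0).1, fun i h => by simp [hy' i, h],
    fun i h => by simp [hy' i, h.not_gt]⟩

theorem IsGroupShift.isFiniteType [Finite H] [TopologicalSpace H] [DiscreteTopology H]
    (hG : IsGroupShift G) : IsFiniteType G := by
  obtain ⟨N, hN⟩ := exists_followerSubgroup_stable G
  refine ⟨N, fun x₁ h₁ x₂ h₂ k heq => ?_⟩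
  obtain ⟨y, hy, hy0, hyx⟩ := exists_mem_truncate hG hN
    (hG.shiftPow_mem (k + N + 1) (G.sub_mem h₂ h₁)) fun i h h' => by
      simp [shiftPow, heq (i + (k + N + 1)) (by omega) (by omega)]
  have hleft : ∀ i : ℤ, i ≤ k + N → y (i + -(k + N + 1)) = 0 := fun i hi => hy0 _ (by omega)
  refine ⟨x₁ + shiftPow (-(k + N + 1)) y, G.add_mem h₁ (hG.shiftPow_mem _ hy), fun i hi => ?_,
    fun i hi => ?_⟩
  · rw [Pi.add_apply, shiftPow, hleft i hi, add_zero]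
  · rw [Pi.add_apply, shiftPow]
    rcases le_or_gt i (k + N) with h | h
    · rw [hleft i h, add_zero, heq i hi h]
    · rw [hyx _ (by omega), shiftPow, neg_add_cancel_right, Pi.sub_apply, add_sub_cancel]

end GroupShift

/-- Every order controllable group shift `G` over a finite abelian
group is of finite type. -/
theorem orderControllable_finiteType
    {H : Type} [AddCommGroup H] [Fintype H] [TopologicalSpace H] [DiscreteTopology H]
    (G : AddSubgroup (ℤ → H)) (hG : IsGroupShift G) (hoc : IsOrderControllable G) :
    IsFiniteType G :=
  hG.isFiniteType
end
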